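/- Let (d, nbr) be a topologically ordered out-indexed DAG on Fin n, let L ≥ 1, and fix a start vertex s : Fin n. Define Φ, Ψ : (Fin n → ZMod L) → (Fin n → ZMod L) by Φ R = (fwdWalk R s).2 and Ψ R = (revWalk R s).2. Then for every K : ℕ and every register configuration R, Ψ^[K] (Φ^[K] R) = R; that is, K forward walks followed by K reverse walks restore the register configuration. -/

import Mathlib

def fwdWalk {n : ℕ} (d : Fin n → ℕ) (nbr : (v : Fin n) → Fin (d v) → Fin n)
    (hmono : ∀ (v : Fin n) (r : Fin (d v)), v < nbr v r)
    {L : ℕ} (R : Fin n → ZMod L) (v : Fin n) : List (Fin n) × (Fin n → ZMod L) :=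
  if h : d v = 0 then ([v], R)
  else
    let r : Fin (d v) := ⟨(R v).val % d v, Nat.mod_lt _ (Nat.pos_of_ne_zero h)⟩
    let R' := Function.update R v (R v + 1)
    let res := fwdWalk d nbr hmono R' (nbr v r)
    (v :: res.1, res.2)
termination_by n - v.val
decreasing_by exact Nat.sub_lt_sub_left v.isLt (hmono v _)

def revWalk {n : ℕ} (d : Fin n → ℕ) (nbr : (v : Fin n) → Fin (d v) → Fin n)
    (hmono : ∀ (v : Fin n) (r : Fin (d v)), v < nbr v r)
    {L : ℕ} (R : Fin n → ZMod L) (v : Fin n) : List (Fin n) × (Fin n → ZMod L) :=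
  if h : d v = 0 then ([v], R)
  else
    let R' := Function.update R v (R v - 1)
    let r : Fin (d v) := ⟨(R' v).val % d v, Nat.mod_lt _ (Nat.pos_of_ne_zero h)⟩
    let res := revWalk d nbr hmono R' (nbr v r)
    (v :: res.1, res.2)
termination_by n - v.val
decreasing_by exact Nat.sub_lt_sub_left v.isLt (hmono v _)

theorem fwdWalk_lt {n : ℕ} (d : Fin n → ℕ) (nbr : (v : Fin n) → Fin (d v) → Fin n)
    (hmono : ∀ (v : Fin n) (r : Fin (d v)), v < nbr v r)
    {L : ℕ} (R : Fin n → ZMod L) (v w : Fin n) (hw : w < v) :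
    (fwdWalk d nbr hmono R v).2 w = R w := by
  rw [fwdWalk]
  split_ifs with h
  · rfl
  · dsimp only
    rw [fwdWalk_lt d nbr hmono _ _ w (hw.trans (hmono v _))]
    exact Function.update_of_ne hw.ne _ _
termination_by n - v.val
decreasing_by exact Nat.sub_lt_sub_left v.isLt (hmono v _)

theorem revWalk_update {n : ℕ} (d : Fin n → ℕ) (nbr : (v : Fin n) → Fin (d v) → Fin n)
    (hmono : ∀ (v : Fin n) (r : Fin (d v)), v < nbr v r)
    {L : ℕ} (R : Fin n → ZMod L) (v w : Fin n) (hw : w < v) (a : ZMod L) :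
    (revWalk d nbr hmono (Function.update R w a) v).2
      = Function.update (revWalk d nbr hmono R v).2 w a := by
  rw [revWalk, revWalk]
  split_ifs with h
  · rfl
  · simp only [Function.update_self, Function.update_of_ne hw.ne']
    exact (congrArg (fun X => (revWalk d nbr hmono X _).2)
      (Function.update_comm hw.ne a (R v - 1) R).symm).symm.trans
      (revWalk_update d nbr hmono _ _ w (hw.trans (hmono v _)) a)
termination_by n - v.val
decreasing_by exact Nat.sub_lt_sub_left v.isLt (hmono v _)

theorem revWalk_fwdWalk {n : ℕ} (d : Fin n → ℕ) (nbr : (v : Fin n) → Fin (d v) → Fin n)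
    (hmono : ∀ (v : Fin n) (r : Fin (d v)), v < nbr v r)
    {L : ℕ} (R : Fin n → ZMod L) (v : Fin n) :
    (revWalk d nbr hmono (fwdWalk d nbr hmono R v).2 v).2 = R := by
  by_cases h : d v = 0
  · rw [fwdWalk, dif_pos h, revWalk, dif_pos h]
  · have hf : (fwdWalk d nbr hmono R v).2 = (fwdWalk d nbr hmono (Function.update R v (R v + 1))
        (nbr v ⟨(R v).val % d v, Nat.mod_lt _ (Nat.pos_of_ne_zero h)⟩)).2 := by
      rw [fwdWalk, dif_neg h]
    have hv : (fwdWalk d nbr hmono R v).2 v = R v + 1 := by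
      rw [hf, fwdWalk_lt d nbr hmono _ _ v (hmono v _), Function.update_self]
    rw [revWalk, dif_neg h]
    simp only [Function.update_self, hv, add_sub_cancel_right]
    rw [revWalk_update d nbr hmono _ _ v (hmono v _)]
    have ih := revWalk_fwdWalk d nbr hmono (Function.update R v (R v + 1))
      (nbr v ⟨(R v).val % d v, Nat.mod_lt _ (Nat.pos_of_ne_zero h)⟩)
    rw [← hf] at ih
    refine (congrArg (fun X => Function.update X v (R v)) ih).trans ?_
    simp
termination_by n - v.val
decreasing_by exact Nat.sub_lt_sub_left v.isLt (hmono v _)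

theorem iterated_reverse_restores_tape (n : ℕ) (d : Fin n → ℕ)
    (nbr : (v : Fin n) → Fin (d v) → Fin n)
    (hmono : ∀ (v : Fin n) (r : Fin (d v)), v < nbr v r)
    (L : ℕ) (hL : 1 ≤ L) (s : Fin n) (K : ℕ) (R : Fin n → ZMod L) :
    (fun R' => (revWalk d nbr hmono R' s).2)^[K]
      ((fun R' => (fwdWalk d nbr hmono R' s).2)^[K] R) = R := by
  exact Function.LeftInverse.iterate (fun R' => revWalk_fwdWalk d nbr hmono R' s) K R
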